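/- Saddle point with explicit descent direction after rank increment: Let f : S^n → ℝ be twice continuously differentiable with gradient ∇f(X) ∈ S^n. Let Y ∈ ℝ^{n×p} satisfy Tr(Yᵀ A_i Y) = b_i for all i, and let λ ∈ ℝ^m satisfy S_Y Y = 0, where S_Y := ∇f(YYᵀ) − Σ_{i=1}^m λ_i A_i. Let v ∈ ℝ^n, and define Y₀ = [Y | 0] ∈ ℝ^{n×(p+1)} (Y with a zero column appended) and Z = [0 | v] ∈ ℝ^{n×(p+1)} (zero columns except last column v). Then: (i) Y₀ is feasible, i.e. Tr(Y₀ᵀ A_i Y₀) = b_i for all i, and S_Y Y₀ = 0; (ii) the function φ(t) = f((Y₀+tZ)(Y₀+tZ)ᵀ) − Σ_{i=1}^m λ_i Tr((Y₀+tZ)ᵀ A_i (Y₀+tZ)) satisfies φ''(0) = 2 vᵀ S_Y v. In particular, if vᵀ S_Y v < 0, then Z is a direction of strictly negative curvature of the Lagrangian at Y₀. -/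

import Mathlib

open Matrix BigOperators

attribute [local instance] Matrix.normedAddCommGroup Matrix.normedSpace

/-- The second derivative at `0` of an even reparametrization `t ↦ ψ (t ^ 2)`. -/
theorem iteratedDeriv_two_comp_sq {ψ : ℝ → ℝ} (hψ : ContDiff ℝ 2 ψ) :
    iteratedDeriv 2 (fun t => ψ (t ^ 2)) 0 = 2 * deriv ψ 0 := by
  have hd : ContDiff ℝ 1 (deriv ψ) := (contDiff_succ_iff_deriv.1 hψ).2.2
  have h1 : deriv (fun t => ψ (t ^ 2)) = fun t => deriv ψ (t ^ 2) * (2 * t) := by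
    funext t
    have h := ((hψ.differentiable (by norm_num)) (t ^ 2)).hasDerivAt.comp t (hasDerivAt_pow 2 t)
    simpa [Function.comp_def] using h.deriv
  have h2 : HasDerivAt (fun t : ℝ => deriv ψ (t ^ 2)) 0 0 := by
    have h := ((hd.differentiable one_ne_zero) ((0 : ℝ) ^ 2)).hasDerivAt.comp (0 : ℝ)
      (hasDerivAt_pow 2 (0 : ℝ))
    simpa [Function.comp_def] using h
  have h3 := h2.mul ((hasDerivAt_id (0 : ℝ)).const_mul 2)
  rw [iteratedDeriv_succ, iteratedDeriv_one, h1]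
  refine h3.deriv.trans ?_
  simp [mul_comm]

/-- The Gram matrix along the line `[Y | 0] + t [0 | v]` is `Y Yᵀ + t² v vᵀ`. -/
theorem gram_append_column {n p : ℕ} (Y : Matrix (Fin n) (Fin p) ℝ) (v : Fin n → ℝ) (t : ℝ)
    (Y0 Z : Matrix (Fin n) (Fin (p + 1)) ℝ)
    (hY0 : Y0 = Matrix.of fun i j => Fin.lastCases 0 (fun k => Y i k) j)
    (hZ : Z = Matrix.of fun i j => Fin.lastCases (v i) (fun _ => 0) j) :
    (Y0 + t • Z) * (Y0 + t • Z)ᵀ = Y * Yᵀ + t ^ 2 • vecMulVec v v := by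
  subst hY0 hZ
  ext i j
  simp [Matrix.mul_apply, Fin.sum_univ_castSucc, vecMulVec_apply]
  ring

/-- `Tr (M v vᵀ) = vᵀ M v`. -/
theorem trace_mul_vecMulVec_self {n : ℕ} (M : Matrix (Fin n) (Fin n) ℝ) (v : Fin n → ℝ) :
    (M * vecMulVec v v).trace = v ⬝ᵥ (M *ᵥ v) := by
  rw [mul_vecMulVec, trace_vecMulVec, dotProduct_comm]

/-- Saddle point with explicit descent direction after the rank
increment: the zero-padded point `Y₀ = [Y | 0]` is feasible and critical, and
the second derivative of the Lagrangian along `Z = [0 | v]` equals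
`2 vᵀ S_Y v`; in particular `vᵀ S_Y v < 0` gives strictly negative curvature. -/
theorem rank_increment_descent_direction {n p m : ℕ}
    (A : Fin m → Matrix (Fin n) (Fin n) ℝ) (b : Fin m → ℝ)
    (hA : ∀ i, (A i).IsSymm)
    (f : Matrix (Fin n) (Fin n) ℝ → ℝ)
    (g : Matrix (Fin n) (Fin n) ℝ → Matrix (Fin n) (Fin n) ℝ)
    (hf : ContDiff ℝ 2 f)
    (hgrad : ∀ X H : Matrix (Fin n) (Fin n) ℝ,
      HasDerivAt (fun t : ℝ => f (X + t • H)) ((g X * H).trace) 0)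
    (Y : Matrix (Fin n) (Fin p) ℝ)
    (hfeas : ∀ i, (Yᵀ * A i * Y).trace = b i)
    (l : Fin m → ℝ)
    (hSYY : (g (Y * Yᵀ) - ∑ i, l i • A i) * Y = 0)
    (v : Fin n → ℝ) :
    let SY : Matrix (Fin n) (Fin n) ℝ := g (Y * Yᵀ) - ∑ i, l i • A i
    let Y0 : Matrix (Fin n) (Fin (p + 1)) ℝ :=
      Matrix.of fun i j => Fin.lastCases 0 (fun k => Y i k) j
    let Z : Matrix (Fin n) (Fin (p + 1)) ℝ :=
      Matrix.of fun i j => Fin.lastCases (v i) (fun _ => 0) j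
    let φ : ℝ → ℝ := fun t =>
      f ((Y0 + t • Z) * (Y0 + t • Z)ᵀ)
        - ∑ i, l i * ((Y0 + t • Z)ᵀ * A i * (Y0 + t • Z)).trace
    (∀ i, (Y0ᵀ * A i * Y0).trace = b i) ∧ SY * Y0 = 0 ∧
    iteratedDeriv 2 φ 0 = 2 * (v ⬝ᵥ (SY *ᵥ v)) ∧
    (v ⬝ᵥ (SY *ᵥ v) < 0 → iteratedDeriv 2 φ 0 < 0) := by
  intro SY Y0 Z φ
  have hgram (t : ℝ) := gram_append_column Y v t Y0 Z rfl rfl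
  have hgram0 : Y0 * Y0ᵀ = Y * Yᵀ := by simpa using hgram 0
  have htr {q : ℕ} (M : Matrix (Fin n) (Fin n) ℝ) (U : Matrix (Fin n) (Fin q) ℝ) :
      (Uᵀ * M * U).trace = (M * (U * Uᵀ)).trace := by
    rw [Matrix.mul_assoc, Matrix.trace_mul_comm, Matrix.mul_assoc]
  set W := vecMulVec v v with hW
  let ψ : ℝ → ℝ := fun s =>
    f (Y * Yᵀ + s • W) - ∑ i, l i * ((A i * (Y * Yᵀ)).trace + s * (A i * W).trace)
  have hφ : φ = fun t => ψ (t ^ 2) := by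
    funext t
    simp only [φ, ψ, htr, hgram]
    simp only [Matrix.mul_add, Matrix.mul_smul, trace_add, trace_smul, smul_eq_mul]
  have hψ : ContDiff ℝ 2 ψ := by
    refine (hf.comp (contDiff_const.add (contDiff_id.smul contDiff_const))).sub ?_
    fun_prop
  have hψ' : HasDerivAt ψ ((g (Y * Yᵀ) * W).trace - ∑ i, l i * (A i * W).trace) 0 := by
    refine (hgrad _ _).sub (HasDerivAt.fun_sum fun i _ => ?_)
    simpa using (((hasDerivAt_id (0 : ℝ)).mul_const (A i * W).trace).const_add
      (A i * (Y * Yᵀ)).trace).const_mul (l i)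
  have hcurv : iteratedDeriv 2 φ 0 = 2 * (v ⬝ᵥ (SY *ᵥ v)) := by
    rw [hφ, iteratedDeriv_two_comp_sq hψ, hψ'.deriv, ← trace_mul_vecMulVec_self]
    simp only [SY, Matrix.sub_mul, Matrix.sum_mul, Matrix.smul_mul, trace_sub, trace_sum,
      trace_smul, smul_eq_mul, hW]
  refine ⟨fun i => ?_, ?_, hcurv, fun h => ?_⟩
  · rw [htr, hgram0, ← htr, hfeas]
  · ext i j
    refine Fin.lastCases ?_ (fun k => ?_) j
    · simp [Y0, Matrix.mul_apply]
    · simpa [Y0, SY, Matrix.mul_apply] using congrFun (congrFun hSYY i) k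
  · rw [hcurv]
    linarith
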